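/- Pinching by a projection valued measure does not increase relative entropy: for density matrices σ, τ and a family {E_i} of mutually orthogonal projections summing to I, one has S(∑_i E_i σ E_i, ∑_i E_i τ E_i) ≤ S(σ, τ). -/

import Mathlib

open Matrix Kronecker
open scoped BigOperators ComplexOrder

variable {n m : Type*}

/-- Functional-calculus logarithm of a Hermitian matrix, restricted to its support
(zero eigenvalues are sent to zero). Returns 0 for non-Hermitian matrices. -/
noncomputable def matLog [Fintype n] [DecidableEq n] (A : Matrix n n ℂ) : Matrix n n ℂ :=
  if h : A.IsHermitian then
    (h.eigenvectorUnitary : Matrix n n ℂ) *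
      Matrix.diagonal (fun i => (Real.log (h.eigenvalues i) : ℂ)) *
      (star (h.eigenvectorUnitary : Matrix n n ℂ))
  else 0

/-- Extended Umegaki relative entropy `S(A,B) = Tr[A(log A − log B)]` (real part). -/
noncomputable def relEnt [Fintype n] [DecidableEq n] (A B : Matrix n n ℂ) : ℝ :=
  ((A * (matLog A - matLog B)).trace).re

/-- von Neumann entropy `S(ρ) = −Tr[ρ log ρ]`. -/
noncomputable def vnEnt [Fintype n] [DecidableEq n] (ρ : Matrix n n ℂ) : ℝ :=
  -((ρ * matLog ρ).trace).re

/-- A density matrix: positive semidefinite with unit trace. -/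
def IsDensity [Fintype n] [DecidableEq n] (ρ : Matrix n n ℂ) : Prop :=
  ρ.PosSemidef ∧ ρ.trace = 1

/-- Completely positive trace-preserving map, via a Kraus representation. -/
def IsCPTP [Fintype n] [DecidableEq n] [Fintype m] [DecidableEq m]
    (Λ : Matrix n n ℂ → Matrix m m ℂ) : Prop :=
  ∃ (ι : Type) (_ : Fintype ι) (K : ι → Matrix m n ℂ),
    (∀ A, Λ A = ∑ i, K i * A * (K i)ᴴ) ∧ (∑ i, (K i)ᴴ * K i = 1)

/-- An orthogonal resolution of the identity (projection valued measure). -/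
def OrthRes [Fintype n] [DecidableEq n] {ι : Type*} [Fintype ι]
    (E : ι → Matrix n n ℂ) : Prop :=
  (∀ i, (E i).IsHermitian) ∧ (∀ i, E i * E i = E i) ∧
  (∀ i j, i ≠ j → E i * E j = 0) ∧ (∑ i, E i = 1)

/-- A Schatten decomposition of ρ: rank-one orthogonal spectral projections. -/
def SchattenDecomp [Fintype n] [DecidableEq n]
    (ρ : Matrix n n ℂ) (lam : n → ℝ) (E : n → Matrix n n ℂ) : Prop :=
  (∀ k, 0 ≤ lam k) ∧ OrthRes E ∧ (∀ k, (E k).trace = 1) ∧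
  ρ = ∑ k, (lam k : ℂ) • E k

/-- Ohya's quantum mutual entropy `I(ρ;Λ*)`. -/
noncomputable def mutEnt [Fintype n] [DecidableEq n] [Fintype m] [DecidableEq m]
    (ρ : Matrix n n ℂ) (Λ : Matrix n n ℂ → Matrix m m ℂ) : ℝ :=
  sSup {x : ℝ | ∃ lam E, SchattenDecomp ρ lam E ∧
    x = ∑ k, lam k * relEnt (Λ (E k)) (Λ ρ)}

open Filter Topology

section Pinching

variable {ι : Type*} [Fintype ι] [Fintype n]

/-- The block-diagonal part of `A` with respect to the family `E`. -/
def pinching (E : ι → Matrix n n ℂ) (A : Matrix n n ℂ) : Matrix n n ℂ :=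
  ∑ i, E i * A * E i

theorem trace_pinching_mul (E : ι → Matrix n n ℂ) (A B : Matrix n n ℂ) :
    (pinching E A * B).trace = (A * pinching E B).trace := by
  simp only [pinching, Finset.sum_mul, Finset.mul_sum, trace_sum]
  refine Finset.sum_congr rfl fun i _ => ?_
  rw [Matrix.mul_assoc, Matrix.mul_assoc, trace_mul_comm]
  simp only [Matrix.mul_assoc]

theorem pinching_mul_of_commute {E : ι → Matrix n n ℂ} {A : Matrix n n ℂ}
    (hA : ∀ i, Commute (E i) A) (B : Matrix n n ℂ) :
    pinching E (A * B) = A * pinching E B := by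
  simp only [pinching, Finset.mul_sum]
  refine Finset.sum_congr rfl fun i _ => ?_
  rw [← Matrix.mul_assoc, (hA i).eq]
  simp only [Matrix.mul_assoc]

theorem pinching_mul_of_commute_right {E : ι → Matrix n n ℂ} {A : Matrix n n ℂ}
    (hA : ∀ i, Commute (E i) A) (B : Matrix n n ℂ) :
    pinching E (B * A) = pinching E B * A := by
  simp only [pinching, Finset.sum_mul]
  refine Finset.sum_congr rfl fun i _ => ?_
  simp only [Matrix.mul_assoc, (hA i).eq]

variable [DecidableEq n]

theorem OrthRes.mul_pinching {E : ι → Matrix n n ℂ} (hE : OrthRes E) (A : Matrix n n ℂ) (j : ι) :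
    E j * pinching E A = E j * A * E j := by
  rw [pinching, Finset.mul_sum, Finset.sum_eq_single j]
  · simp only [← Matrix.mul_assoc, hE.2.1 j]
  · intro i _ hij
    simp only [← Matrix.mul_assoc, hE.2.2.1 j i hij.symm, Matrix.zero_mul]
  · simp

theorem OrthRes.pinching_mul {E : ι → Matrix n n ℂ} (hE : OrthRes E) (A : Matrix n n ℂ) (j : ι) :
    pinching E A * E j = E j * A * E j := by
  rw [pinching, Finset.sum_mul, Finset.sum_eq_single j]
  · simp only [Matrix.mul_assoc, hE.2.1 j]
  · intro i _ hij
    simp only [Matrix.mul_assoc, hE.2.2.1 i j hij, Matrix.mul_zero]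
  · simp

theorem OrthRes.commute_pinching {E : ι → Matrix n n ℂ} (hE : OrthRes E) (A : Matrix n n ℂ)
    (j : ι) : Commute (E j) (pinching E A) :=
  (hE.mul_pinching A j).trans (hE.pinching_mul A j).symm

theorem OrthRes.pinching_of_commute {E : ι → Matrix n n ℂ} (hE : OrthRes E) {A : Matrix n n ℂ}
    (hA : ∀ i, Commute (E i) A) : pinching E A = A := by
  have h1 : pinching E 1 = 1 := by simp [pinching, hE.2.1, hE.2.2.2]
  simpa [h1] using pinching_mul_of_commute hA 1

theorem OrthRes.pinching_pinching {E : ι → Matrix n n ℂ} (hE : OrthRes E) (A : Matrix n n ℂ) :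
    pinching E (pinching E A) = pinching E A :=
  hE.pinching_of_commute (hE.commute_pinching A)

theorem OrthRes.trace_pinching {E : ι → Matrix n n ℂ} (hE : OrthRes E) (A : Matrix n n ℂ) :
    (pinching E A).trace = A.trace := by
  simpa [hE.pinching_of_commute fun i => Commute.one_right (E i)] using
    trace_pinching_mul E A 1

theorem OrthRes.posSemidef_pinching {E : ι → Matrix n n ℂ} (hE : OrthRes E) {A : Matrix n n ℂ}
    (hA : A.PosSemidef) : (pinching E A).PosSemidef := by
  refine posSemidef_sum _ fun i _ => ?_
  simpa [(hE.1 i).eq] using hA.mul_mul_conjTranspose_same (E i)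

theorem OrthRes.pinching_mulVec_eq_zero {E : ι → Matrix n n ℂ} (hE : OrthRes E)
    {σ τ : Matrix n n ℂ} (hτ : τ.PosSemidef)
    (hsupp : ∀ v : n → ℂ, τ *ᵥ v = 0 → σ *ᵥ v = 0) (v : n → ℂ)
    (hv : pinching E τ *ᵥ v = 0) : pinching E σ *ᵥ v = 0 := by
  rw [pinching, Matrix.sum_mulVec]
  refine Finset.sum_eq_zero fun i _ => ?_
  have h : (E i * τ * E i) *ᵥ v = 0 := by
    rw [← hE.mul_pinching, ← mulVec_mulVec, hv, mulVec_zero]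
  have h2 : τ *ᵥ (E i *ᵥ v) = 0 := by
    refine (hτ.dotProduct_mulVec_zero_iff _).1 ?_
    rw [star_mulVec, (hE.1 i).eq, ← dotProduct_mulVec, mulVec_mulVec, mulVec_mulVec,
      h, dotProduct_zero]
  rw [Matrix.mul_assoc, ← mulVec_mulVec, ← mulVec_mulVec, hsupp _ h2, mulVec_zero]

end Pinching

section Variational

variable [Fintype n] {σ τ X Y : Matrix n n ℂ} {r : ℝ}

/-- The quadratic functional whose maximum over `Y` is the resolvent of the relative modular
operator evaluated at `σ`. -/
def modularFunctional (σ τ : Matrix n n ℂ) (r : ℝ) (Y : Matrix n n ℂ) : ℝ :=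
  2 * (σ * Y).trace.re - (Yᴴ * τ * Y).trace.re - r * (Y * σ * Yᴴ).trace.re

theorem trace_mul_eq_of_sylvester (hX : τ * X + (r : ℂ) • (X * σ) = σ) (Y : Matrix n n ℂ) :
    (Yᴴ * τ * X).trace.re + r * (X * σ * Yᴴ).trace.re = (Yᴴ * σ).trace.re := by
  have h := congrArg (fun Z => (Yᴴ * Z).trace.re) hX
  simp only [Matrix.mul_add, trace_add, Matrix.mul_smul, trace_smul, smul_eq_mul, Complex.add_re,
    Complex.re_ofReal_mul] at h
  rw [← h, Matrix.mul_assoc, trace_mul_comm (X * σ)]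

theorem re_trace_conjTranspose (A : Matrix n n ℂ) : Aᴴ.trace.re = A.trace.re := by
  simp [trace_conjTranspose]

theorem re_trace_conjTranspose_mul (hσ : σ.IsHermitian) (Y : Matrix n n ℂ) :
    (Yᴴ * σ).trace.re = (σ * Y).trace.re := by
  rw [← re_trace_conjTranspose (σ * Y), conjTranspose_mul, hσ.eq]

theorem modularFunctional_of_sylvester (hσ : σ.IsHermitian)
    (hX : τ * X + (r : ℂ) • (X * σ) = σ) :
    modularFunctional σ τ r X = (σ * X).trace.re := by
  have h := trace_mul_eq_of_sylvester hX X
  rw [re_trace_conjTranspose_mul hσ] at h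
  rw [modularFunctional]
  linarith

theorem modularFunctional_le (hσ : σ.PosSemidef) (hτ : τ.PosSemidef) (hr : 0 ≤ r)
    (hX : τ * X + (r : ℂ) • (X * σ) = σ) (Y : Matrix n n ℂ) :
    modularFunctional σ τ r Y ≤ (σ * X).trace.re := by
  have hXX := trace_mul_eq_of_sylvester hX X
  have hXY := trace_mul_eq_of_sylvester hX Y
  rw [re_trace_conjTranspose_mul hσ.1] at hXX hXY
  have h1 : 0 ≤ ((X - Y)ᴴ * τ * (X - Y)).trace.re :=
    (Complex.le_def.1 (hτ.conjTranspose_mul_mul_same (X - Y)).trace_nonneg).1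
  have h2 : 0 ≤ ((X - Y) * σ * (X - Y)ᴴ).trace.re :=
    (Complex.le_def.1 (hσ.mul_mul_conjTranspose_same (X - Y)).trace_nonneg).1
  have e1 : (Xᴴ * τ * Y).trace.re = (Yᴴ * τ * X).trace.re := by
    rw [← re_trace_conjTranspose (Yᴴ * τ * X)]
    simp [Matrix.mul_assoc, hτ.1.eq]
  have e2 : (Y * σ * Xᴴ).trace.re = (X * σ * Yᴴ).trace.re := by
    rw [← re_trace_conjTranspose (X * σ * Yᴴ)]
    simp [Matrix.mul_assoc, hσ.1.eq]
  have h3 := mul_nonneg hr h2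
  simp only [conjTranspose_sub, Matrix.sub_mul, Matrix.mul_sub, trace_sub, Complex.sub_re, e1, e2]
    at h1 h3
  rw [modularFunctional]
  linarith

theorem sylvester_trace_pinching_le [DecidableEq n] {ι : Type*} [Fintype ι]
    {E : ι → Matrix n n ℂ} (hE : OrthRes E)
    (hσ : σ.PosSemidef) (hτ : τ.PosSemidef) (hr : 0 ≤ r)
    (hX : τ * X + (r : ℂ) • (X * σ) = σ)
    (hY : pinching E τ * Y + (r : ℂ) • (Y * pinching E σ) = pinching E σ) :
    (pinching E σ * Y).trace.re ≤ (σ * X).trace.re := by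
  set Z := pinching E Y with hZ
  have hcZ := hE.commute_pinching Y
  have hcZ' : ∀ i, Commute (E i) Zᴴ := fun i => by
    have := congrArg conjTranspose (hcZ i).eq
    simp only [conjTranspose_mul, (hE.1 i).eq] at this
    exact this.symm
  have hsol : pinching E τ * Z + (r : ℂ) • (Z * pinching E σ) = pinching E σ := by
    have h := congrArg (pinching E) hY
    rw [hE.pinching_pinching] at h
    rw [hZ, ← pinching_mul_of_commute (hE.commute_pinching τ),
      ← pinching_mul_of_commute_right (hE.commute_pinching σ)]
    refine Eq.trans ?_ h
    simp [pinching, Matrix.mul_add, Matrix.add_mul, Finset.sum_add_distrib, Finset.smul_sum]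
  have hval : (pinching E σ * Y).trace = (pinching E σ * Z).trace := by
    rw [hZ, ← trace_pinching_mul, hE.pinching_pinching]
  have hfun : modularFunctional (pinching E σ) (pinching E τ) r Z = modularFunctional σ τ r Z := by
    have a1 : (pinching E σ * Z).trace = (σ * Z).trace := by
      rw [trace_pinching_mul, hZ, hE.pinching_pinching]
    have a2 : (Zᴴ * pinching E τ * Z).trace = (Zᴴ * τ * Z).trace := by
      rw [← pinching_mul_of_commute hcZ', ← pinching_mul_of_commute_right hcZ, hE.trace_pinching]
    have a3 : (Z * pinching E σ * Zᴴ).trace = (Z * σ * Zᴴ).trace := by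
      rw [← pinching_mul_of_commute hcZ, ← pinching_mul_of_commute_right hcZ', hE.trace_pinching]
    rw [modularFunctional, modularFunctional, a1, a2, a3]
  rw [hval, ← modularFunctional_of_sylvester (hE.posSemidef_pinching hσ).1 hsol, hfun]
  exact modularFunctional_le hσ hτ hr hX Z

end Variational

section Spectral

variable [Fintype n] [DecidableEq n] {σ τ : Matrix n n ℂ}

/-- The overlap `|⟨bⱼ, aᵢ⟩|²` of the eigenvectors of `σ` and `τ`. -/
noncomputable def eigenOverlap (hσ : σ.IsHermitian) (hτ : τ.IsHermitian) (p : n × n) : ℝ :=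
  Complex.normSq ((star (hτ.eigenvectorUnitary : Matrix n n ℂ) *
    (hσ.eigenvectorUnitary : Matrix n n ℂ)) p.2 p.1)

theorem trace_spectral_mul_spectral (hσ : σ.IsHermitian) (hτ : τ.IsHermitian) (f g : n → ℝ) :
    (((hσ.eigenvectorUnitary : Matrix n n ℂ) * diagonal (fun i => (f i : ℂ)) *
        star (hσ.eigenvectorUnitary : Matrix n n ℂ)) *
      ((hτ.eigenvectorUnitary : Matrix n n ℂ) * diagonal (fun i => (g i : ℂ)) *
        star (hτ.eigenvectorUnitary : Matrix n n ℂ))).trace.re =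
      ∑ p : n × n, eigenOverlap hσ hτ p * f p.1 * g p.2 := by
  set U := (hσ.eigenvectorUnitary : Matrix n n ℂ)
  set V := (hτ.eigenvectorUnitary : Matrix n n ℂ)
  have h : ((U * diagonal (fun i => (f i : ℂ)) * star U) *
      (V * diagonal (fun i => (g i : ℂ)) * star V)).trace =
      (diagonal (fun i => (f i : ℂ)) * (star V * U)ᴴ * diagonal (fun i => (g i : ℂ)) *
        (star V * U)).trace := by
    simp only [Matrix.mul_assoc, star_eq_conjTranspose, conjTranspose_mul,
      conjTranspose_conjTranspose]
    rw [trace_mul_comm]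
    simp only [Matrix.mul_assoc]
  rw [h, Fintype.sum_prod_type, trace, Complex.re_sum]
  refine Finset.sum_congr rfl fun a _ => ?_
  rw [diag_apply, Matrix.mul_apply, Complex.re_sum]
  refine Finset.sum_congr rfl fun b _ => ?_
  rw [mul_diagonal, diagonal_mul, conjTranspose_apply, eigenOverlap, Complex.normSq_apply]
  simp [U, V]
  ring

theorem Matrix.IsHermitian.eq_eigenvectorUnitary_mul (hσ : σ.IsHermitian) :
    σ = (hσ.eigenvectorUnitary : Matrix n n ℂ) * diagonal (fun i => (hσ.eigenvalues i : ℂ)) *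
      star (hσ.eigenvectorUnitary : Matrix n n ℂ) := by
  conv_lhs => rw [hσ.spectral_theorem]
  rfl

theorem trace_re_eq_sum_eigenOverlap (hσ : σ.IsHermitian) (hτ : τ.IsHermitian) :
    σ.trace.re = ∑ p : n × n, eigenOverlap hσ hτ p * hσ.eigenvalues p.1 := by
  have h := trace_spectral_mul_spectral hσ hτ hσ.eigenvalues 1
  rw [← hσ.eq_eigenvectorUnitary_mul] at h
  simpa using h

theorem relEnt_eq_sum_eigenOverlap (hσ : σ.IsHermitian) (hτ : τ.IsHermitian) :
    relEnt σ τ = ∑ p : n × n, eigenOverlap hσ hτ p * hσ.eigenvalues p.1 *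
      (Real.log (hσ.eigenvalues p.1) - Real.log (hτ.eigenvalues p.2)) := by
  have h1 := trace_spectral_mul_spectral hσ hτ hσ.eigenvalues
    (fun b => Real.log (hτ.eigenvalues b))
  rw [← hσ.eq_eigenvectorUnitary_mul] at h1
  have h2 := trace_spectral_mul_spectral hσ hτ
    (fun a => hσ.eigenvalues a * Real.log (hσ.eigenvalues a)) 1
  have h3 : σ * matLog σ = (hσ.eigenvectorUnitary : Matrix n n ℂ) *
      diagonal (fun i => ((hσ.eigenvalues i * Real.log (hσ.eigenvalues i) : ℝ) : ℂ)) *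
        star (hσ.eigenvectorUnitary : Matrix n n ℂ) := by
    rw [matLog, dif_pos hσ]
    conv_lhs => enter [1]; rw [hσ.eq_eigenvectorUnitary_mul]
    simp only [Matrix.mul_assoc]
    rw [← Matrix.mul_assoc (star _) _ (_ * _), Unitary.coe_star_mul_self, Matrix.one_mul,
      ← Matrix.mul_assoc (diagonal _), diagonal_mul_diagonal]
    simp
  rw [← h3] at h2
  have h4 : matLog τ = (hτ.eigenvectorUnitary : Matrix n n ℂ) *
      diagonal (fun i => (Real.log (hτ.eigenvalues i) : ℂ)) *
        star (hτ.eigenvectorUnitary : Matrix n n ℂ) := by rw [matLog, dif_pos hτ]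
  rw [relEnt, Matrix.mul_sub, trace_sub, Complex.sub_re, h4, h1]
  have h5 : (hτ.eigenvectorUnitary : Matrix n n ℂ) *
      star (hτ.eigenvectorUnitary : Matrix n n ℂ) = 1 := Unitary.coe_mul_star_self _
  simp only [Pi.one_apply, Complex.ofReal_one, diagonal_one, Matrix.mul_one, h5] at h2
  rw [h2, ← Finset.sum_sub_distrib]
  exact Finset.sum_congr rfl fun p _ => by ring

theorem exists_sylvester_trace_eq (hσ : σ.PosSemidef) (hτ : τ.PosSemidef) {r : ℝ} (hr : 0 < r) :
    ∃ X : Matrix n n ℂ, τ * X + (r : ℂ) • (X * σ) = σ ∧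
      (σ * X).trace.re = ∑ p : n × n, eigenOverlap hσ.1 hτ.1 p * hσ.1.eigenvalues p.1 *
        (hσ.1.eigenvalues p.1 / (hτ.1.eigenvalues p.2 + r * hσ.1.eigenvalues p.1)) := by
  set U := (hσ.1.eigenvectorUnitary : Matrix n n ℂ) with hU
  set V := (hτ.1.eigenvectorUnitary : Matrix n n ℂ) with hV
  set s := hσ.1.eigenvalues
  set t := hτ.1.eigenvalues
  have hUU : star U * U = 1 := Unitary.coe_star_mul_self _
  have hVV : star V * V = 1 := Unitary.coe_star_mul_self _
  have hVV' : V * star V = 1 := Unitary.coe_mul_star_self _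
  have hσU : σ = U * diagonal (fun i => (s i : ℂ)) * star U := hσ.1.eq_eigenvectorUnitary_mul
  have hτV : τ = V * diagonal (fun i => (t i : ℂ)) * star V := hτ.1.eq_eigenvectorUnitary_mul
  set N : Matrix n n ℂ := of fun b a => (star V * U) b a * ((s a / (t b + r * s a) : ℝ) : ℂ) with hN
  have hNeq : diagonal (fun i => (t i : ℂ)) * N + (r : ℂ) • (N * diagonal (fun i => (s i : ℂ))) =
      star V * U * diagonal (fun i => (s i : ℂ)) := by
    ext b a
    simp only [Matrix.add_apply, Matrix.smul_apply, diagonal_mul, mul_diagonal, hN, of_apply, smul_eq_mul]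
    have key : t b * (s a / (t b + r * s a)) + r * (s a / (t b + r * s a) * s a) = s a := by
      have hsa : 0 ≤ s a := hσ.eigenvalues_nonneg a
      have htb : 0 ≤ t b := hτ.eigenvalues_nonneg b
      rcases hsa.eq_or_lt with h | h
      · simp [← h]
      · have : 0 < t b + r * s a := by positivity
        field_simp
    have keyC : (t b : ℂ) * ((s a / (t b + r * s a) : ℝ) : ℂ) +
        r * (((s a / (t b + r * s a) : ℝ) : ℂ) * s a) = s a := mod_cast key
    linear_combination (star V * U) b a * keyC
  refine ⟨V * N * star U, ?_, ?_⟩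
  · have e1 : τ * (V * N * star U) = V * (diagonal (fun i => (t i : ℂ)) * N) * star U := by
      calc τ * (V * N * star U)
          = V * diagonal (fun i => (t i : ℂ)) * (star V * V) * N * star U := by
            rw [hτV]; simp only [Matrix.mul_assoc]
        _ = _ := by rw [hVV]; simp only [Matrix.mul_assoc, Matrix.one_mul]
    have e2 : V * N * star U * σ = V * (N * diagonal (fun i => (s i : ℂ))) * star U := by
      calc V * N * star U * σ
          = V * N * (star U * U) * diagonal (fun i => (s i : ℂ)) * star U := by
            rw [hσU]; simp only [Matrix.mul_assoc]
        _ = _ := by rw [hUU]; simp only [Matrix.mul_assoc, Matrix.one_mul]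
    rw [e1, e2, ← Matrix.smul_mul, ← Matrix.mul_smul, ← Matrix.add_mul, ← Matrix.mul_add, hNeq]
    calc V * (star V * U * diagonal (fun i => (s i : ℂ))) * star U
        = (V * star V) * (U * diagonal (fun i => (s i : ℂ)) * star U) := by
          simp only [Matrix.mul_assoc]
      _ = σ := by rw [hVV', Matrix.one_mul, ← hσU]
  · have h : (σ * (V * N * star U)).trace =
        (diagonal (fun i => (s i : ℂ)) * (star V * U)ᴴ * N).trace := by
      calc (σ * (V * N * star U)).trace
          = (U * (diagonal (fun i => (s i : ℂ)) * star U * V * N * star U)).trace := by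
            rw [hσU]; simp only [Matrix.mul_assoc]
        _ = (diagonal (fun i => (s i : ℂ)) * star U * V * N * (star U * U)).trace := by
            rw [trace_mul_comm]; simp only [Matrix.mul_assoc]
        _ = _ := by
            rw [hUU, conjTranspose_mul, star_eq_conjTranspose, star_eq_conjTranspose,
              conjTranspose_conjTranspose]
            simp only [Matrix.mul_assoc, Matrix.mul_one]
    rw [h, Fintype.sum_prod_type, trace, Complex.re_sum]
    refine Finset.sum_congr rfl fun a _ => ?_
    rw [diag_apply, Matrix.mul_apply, Complex.re_sum]
    refine Finset.sum_congr rfl fun b _ => ?_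
    rw [diagonal_mul, conjTranspose_apply, hN, of_apply, eigenOverlap, Complex.normSq_apply]
    simp only [← hU, ← hV, RCLike.star_def, Complex.mul_re, Complex.mul_im, Complex.conj_re,
      Complex.conj_im, Complex.ofReal_re, Complex.ofReal_im]
    ring

theorem eigenOverlap_mul_eq_zero_or_pos (hσ : σ.PosSemidef) (hτ : τ.PosSemidef)
    (hsupp : ∀ v : n → ℂ, τ *ᵥ v = 0 → σ *ᵥ v = 0) (p : n × n) :
    eigenOverlap hσ.1 hτ.1 p * hσ.1.eigenvalues p.1 = 0 ∨
      0 < hσ.1.eigenvalues p.1 ∧ 0 < hτ.1.eigenvalues p.2 := by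
  obtain ⟨a, b⟩ := p
  rcases (hσ.eigenvalues_nonneg a).eq_or_lt with h | hs
  · left; simp [← h]
  rcases (hτ.eigenvalues_nonneg b).eq_or_lt with ht | ht
  swap
  · exact Or.inr ⟨hs, ht⟩
  left
  set U := (hσ.1.eigenvectorUnitary : Matrix n n ℂ) with hU
  set V := (hτ.1.eigenvectorUnitary : Matrix n n ℂ) with hV
  have hUU : star U * U = 1 := Unitary.coe_star_mul_self _
  have hVb : σ *ᵥ (V *ᵥ Pi.single b 1) = 0 := by
    apply hsupp
    have := hτ.1.mulVec_eigenvectorBasis b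
    rw [← ht] at this
    rw [hV, mulVec_single_one]
    simpa [IsHermitian.eigenvectorUnitary_col_eq] using this
  have h1 : star U * σ = diagonal (fun i => (hσ.1.eigenvalues i : ℂ)) * star U := by
    calc star U * σ = (star U * U) * diagonal (fun i => (hσ.1.eigenvalues i : ℂ)) * star U := by
          conv_lhs => rw [hσ.1.eq_eigenvectorUnitary_mul]
          simp only [← hU, Matrix.mul_assoc]
      _ = _ := by rw [hUU, Matrix.one_mul]
  have h2 : (hσ.1.eigenvalues a : ℂ) * (star U * V) a b = 0 := by
    have : (star U *ᵥ (σ *ᵥ (V *ᵥ Pi.single b 1))) a = 0 := by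
      rw [hVb, mulVec_zero, Pi.zero_apply]
    rwa [mulVec_mulVec, mulVec_mulVec, h1, Matrix.mul_assoc, mulVec_single_one,
      col_apply, diagonal_mul] at this
  have h3 : (star U * V) a b = 0 := by
    rcases mul_eq_zero.1 h2 with h | h
    · exact absurd (Complex.ofReal_eq_zero.1 h) hs.ne'
    · exact h
  have h4 : (star V * U) b a = 0 := by
    have : star V * U = (star U * V)ᴴ := by
      simp [star_eq_conjTranspose]
    rw [this, conjTranspose_apply, h3, star_zero]
  simp [eigenOverlap, ← hU, ← hV, h4]

end Spectral

section Interpolation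

variable {κ : Type*} [Fintype κ] {w s t : κ → ℝ}

theorem hasDerivAt_sum_mul_log (h : ∀ k, w k = 0 ∨ 0 < s k ∧ 0 < t k) {r : ℝ} (hr : 0 ≤ r) :
    HasDerivAt (fun x => ∑ k, w k * (Real.log (t k + x * s k) - Real.log (t k)))
      (∑ k, w k * (s k / (t k + r * s k))) r := by
  refine HasDerivAt.fun_sum fun k _ => ?_
  rcases h k with h | ⟨hs, ht⟩
  · simpa [h] using hasDerivAt_const r (0 : ℝ)
  · have hlin : HasDerivAt (fun x => t k + x * s k) (s k) r := by
      simpa using ((hasDerivAt_id r).mul_const (s k)).const_add (t k)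
    exact ((hlin.log (by positivity)).sub_const _).const_mul _

theorem tendsto_sum_mul_log (h : ∀ k, w k = 0 ∨ 0 < s k ∧ 0 < t k) :
    Tendsto (fun x => ∑ k, w k * (Real.log (t k + x * s k) - Real.log (t k)) -
      (∑ k, w k) * Real.log x) atTop (𝓝 (∑ k, w k * (Real.log (s k) - Real.log (t k)))) := by
  simp only [Finset.sum_mul, ← Finset.sum_sub_distrib]
  refine tendsto_finsetSum _ fun k _ => ?_
  rcases h k with h | ⟨hs, ht⟩
  · simp [h]
  · have hlim : Tendsto (fun x : ℝ => t k / x + s k) atTop (𝓝 (s k)) := by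
      simpa using (tendsto_const_nhds (x := t k)).div_atTop tendsto_id |>.add_const (s k)
    refine (((hlim.log hs.ne').sub_const (Real.log (t k))).const_mul (w k)).congr' ?_
    filter_upwards [eventually_gt_atTop 0] with x hx
    have : t k / x + s k = (t k + x * s k) / x := by field_simp
    rw [this, Real.log_div (by positivity) hx.ne']
    ring

theorem sum_mul_log_sub_le {κ' : Type*} [Fintype κ'] {w' s' t' : κ' → ℝ}
    (h : ∀ k, w k = 0 ∨ 0 < s k ∧ 0 < t k) (h' : ∀ k, w' k = 0 ∨ 0 < s' k ∧ 0 < t' k)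
    (hw : ∑ k, w' k = ∑ k, w k)
    (hle : ∀ r, 0 < r → ∑ k, w' k * (s' k / (t' k + r * s' k)) ≤
      ∑ k, w k * (s k / (t k + r * s k))) :
    ∑ k, w' k * (Real.log (s' k) - Real.log (t' k)) ≤
      ∑ k, w k * (Real.log (s k) - Real.log (t k)) := by
  have hd : ∀ r : ℝ, 0 ≤ r → HasDerivAt
      (fun x => ∑ k, w k * (Real.log (t k + x * s k) - Real.log (t k)) -
        ∑ k, w' k * (Real.log (t' k + x * s' k) - Real.log (t' k))) _ r := fun r hr =>
    (hasDerivAt_sum_mul_log h hr).sub (hasDerivAt_sum_mul_log h' hr)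
  have hmono := monotoneOn_of_deriv_nonneg (convex_Ici (0 : ℝ))
    (fun r hr => (hd r hr).continuousAt.continuousWithinAt)
    (fun r hr => (hd r (interior_subset hr)).differentiableAt.differentiableWithinAt)
    (fun r hr => by
      rw [(hd r (interior_subset hr)).deriv]
      rw [interior_Ici] at hr
      exact sub_nonneg.2 (hle r hr))
  refine le_of_tendsto_of_tendsto (tendsto_sum_mul_log h') (tendsto_sum_mul_log h) ?_
  filter_upwards [eventually_ge_atTop 0] with x hx
  have := hmono Set.self_mem_Ici hx hx
  simp only [zero_mul, add_zero, sub_self, mul_zero, Finset.sum_const_zero] at this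
  rw [hw]
  linarith

end Interpolation

/-- Pinching by a projection valued measure does not increase relative entropy. -/
theorem stmt8_pinching_monotone {ι : Type*} [Fintype ι]
    [Fintype n] [DecidableEq n]
    (σ τ : Matrix n n ℂ) (hσ : IsDensity σ) (hτ : IsDensity τ)
    (hsupp : ∀ v : n → ℂ, τ.mulVec v = 0 → σ.mulVec v = 0)
    (E : ι → Matrix n n ℂ) (hE : OrthRes E) :
    relEnt (∑ i, E i * σ * E i) (∑ i, E i * τ * E i) ≤ relEnt σ τ := by
  have hσ' := hE.posSemidef_pinching hσ.1
  have hτ' := hE.posSemidef_pinching hτ.1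
  change relEnt (pinching E σ) (pinching E τ) ≤ relEnt σ τ
  rw [relEnt_eq_sum_eigenOverlap hσ.1.1 hτ.1.1, relEnt_eq_sum_eigenOverlap hσ'.1 hτ'.1]
  refine sum_mul_log_sub_le (eigenOverlap_mul_eq_zero_or_pos hσ.1 hτ.1 hsupp)
    (eigenOverlap_mul_eq_zero_or_pos hσ' hτ' (hE.pinching_mulVec_eq_zero hτ.1 hsupp)) ?_ ?_
  · rw [← trace_re_eq_sum_eigenOverlap, ← trace_re_eq_sum_eigenOverlap, hE.trace_pinching]
  · intro r hr
    obtain ⟨X, hX, hXtr⟩ := exists_sylvester_trace_eq hσ.1 hτ.1 hr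
    obtain ⟨Y, hY, hYtr⟩ := exists_sylvester_trace_eq hσ' hτ' hr
    rw [← hXtr, ← hYtr]
    exact sylvester_trace_pinching_le hE hσ.1 hτ.1 hr.le hX hY
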